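/- Assume the minimal subtrees of T₁ and T₂ are dense in T₁ and T₂. Let Q, Q' be two light quadrants facing each other, based at points x = (x₁, x₂) and x' = (x'₁, x'₂). Then Q ∩ Q' equals the open rectangle ]x₁, x'₁[ × ]x₂, x'₂[, and neither of the open intervals ]xᵢ, x'ᵢ[ contains a branch point of Tᵢ. -/

import Mathlib

/-!
Formalization of definitions from V. Guirardel,
"Core and intersection number for group actions on trees".
-/

open Set Metric Filter Function Topology
open scoped ENNReal Pointwise

noncomputable section

namespace Guirardel

/-- The metric segment `[x,y]`: the set of points lying metrically between `x` and `y`.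
In an `ℝ`-tree this is the image of the geodesic from `x` to `y`. -/
def seg {T : Type*} [MetricSpace T] (x y : T) : Set T :=
  {p : T | dist x p + dist p y = dist x y}

/-- The open segment `]x,y[`. -/
def openSeg {T : Type*} [MetricSpace T] (x y : T) : Set T :=
  seg x y \ {x, y}

/-- A subset of an `ℝ`-tree is convex (i.e. a subtree when nonempty) if it contains the
segment between any two of its points. -/
def TreeConvex {T : Type*} [MetricSpace T] (S : Set T) : Prop :=
  ∀ x ∈ S, ∀ y ∈ S, seg x y ⊆ S

/-- An `ℝ`-tree: any two points are joined by a geodesic, and any two injective paths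
with the same endpoints have the same image (uniqueness of arcs). -/
structure IsRTree (T : Type*) [MetricSpace T] : Prop where
  exists_geod : ∀ x y : T, ∃ f : ℝ → T, f 0 = x ∧ f (dist x y) = y ∧
    ∀ s ∈ Icc (0 : ℝ) (dist x y), ∀ t ∈ Icc (0 : ℝ) (dist x y),
      dist (f s) (f t) = |s - t|
  arc_unique : ∀ (x y : T) (γ₁ γ₂ : Path x y),
    Function.Injective γ₁ → Function.Injective γ₂ →
      Set.range γ₁ = Set.range γ₂

/-- A direction based at `x`: a connected component of the complement of `x`. -/
def IsDirectionAt {T : Type*} [MetricSpace T] (δ : Set T) (x : T) : Prop :=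
  ∃ y : T, y ≠ x ∧ δ = connectedComponentIn {x}ᶜ y

/-- A direction in a tree. -/
def IsDirection {T : Type*} [MetricSpace T] (δ : Set T) : Prop :=
  ∃ x : T, IsDirectionAt δ x

/-- A branch point: a point with at least three directions. -/
def IsBranchPoint {T : Type*} [MetricSpace T] (x : T) : Prop :=
  ∃ δ₁ δ₂ δ₃ : Set T, IsDirectionAt δ₁ x ∧ IsDirectionAt δ₂ x ∧ IsDirectionAt δ₃ x ∧
    δ₁ ≠ δ₂ ∧ δ₁ ≠ δ₃ ∧ δ₂ ≠ δ₃

/-- A quadrant in `T₁ × T₂`: a product of two directions. -/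
def IsQuadrant {T₁ T₂ : Type*} [MetricSpace T₁] [MetricSpace T₂]
    (Q : Set (T₁ × T₂)) : Prop :=
  ∃ (δ₁ : Set T₁) (δ₂ : Set T₂), IsDirection δ₁ ∧ IsDirection δ₂ ∧ Q = δ₁ ×ˢ δ₂

/-- A quadrant is heavy if (for every choice of base point, which does not matter) there
is a sequence of orbit points inside it whose two coordinates go to infinity. -/
def Heavy (G : Type*) {T₁ T₂ : Type*} [Group G] [MetricSpace T₁] [MetricSpace T₂]
    [MulAction G T₁] [MulAction G T₂] (Q : Set (T₁ × T₂)) : Prop :=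
  ∀ p : T₁ × T₂, ∃ γ : ℕ → G,
    (∀ k, ((γ k • p.1 : T₁), (γ k • p.2 : T₂)) ∈ Q) ∧
    Tendsto (fun k => dist (γ k • p.1) p.1) atTop atTop ∧
    Tendsto (fun k => dist (γ k • p.2) p.2) atTop atTop

/-- The core of `T₁ × T₂`: the complement of the union of all light (i.e. non-heavy)
quadrants; equivalently the set of points all of whose quadrants are heavy. -/
def Core (G T₁ T₂ : Type*) [Group G] [MetricSpace T₁] [MetricSpace T₂]
    [MulAction G T₁] [MulAction G T₂] : Set (T₁ × T₂) :=
  {z : T₁ × T₂ | ∀ Q : Set (T₁ × T₂), IsQuadrant Q → z ∈ Q → Heavy G Q}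

/-- A subset of `T₁ × T₂` has convex fibers if its horizontal and vertical fibers
are convex. -/
def ConvexFibers {T₁ T₂ : Type*} [MetricSpace T₁] [MetricSpace T₂]
    (E : Set (T₁ × T₂)) : Prop :=
  (∀ x₁ : T₁, TreeConvex {y₂ : T₂ | (x₁, y₂) ∈ E}) ∧
  (∀ x₂ : T₂, TreeConvex {y₁ : T₁ | (y₁, x₂) ∈ E})

/-- The action of `G` on `T` is by isometries. -/
def IsometricAction (G T : Type*) [MetricSpace T] [SMul G T] : Prop :=
  ∀ (g : G) (x y : T), dist (g • x) (g • y) = dist x y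

/-- `g` is elliptic: it fixes a point of `T`. -/
def Elliptic {G : Type*} (T : Type*) [SMul G T] (g : G) : Prop :=
  ∃ x : T, g • x = x

/-- `g` is hyperbolic: it fixes no point of `T`. -/
def Hyperbolic {G : Type*} (T : Type*) [SMul G T] (g : G) : Prop :=
  ∀ x : T, g • x ≠ x

/-- Translation length of `g` on `T`. -/
def translationLength {G : Type*} (T : Type*) [MetricSpace T] [SMul G T] (g : G) : ℝ :=
  ⨅ x : T, dist x (g • x)

/-- The axis (characteristic set) of `g`: points minimizing displacement. -/
def axisSet {G : Type*} (T : Type*) [MetricSpace T] [SMul G T] (g : G) : Set T :=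
  {x : T | ∀ y : T, dist x (g • x) ≤ dist y (g • y)}

/-- The action is non-trivial: some element is hyperbolic. -/
def NontrivialAction (G T : Type*) [SMul G T] : Prop :=
  ∃ g : G, ∀ x : T, g • x ≠ x

/-- The action is free: only the identity fixes a point. -/
def FreeAction (G T : Type*) [Group G] [MulAction G T] : Prop :=
  ∀ g : G, g ≠ 1 → ∀ x : T, g • x ≠ x

/-- The action is minimal: no proper nonempty invariant subtree. -/
def MinimalAction (G T : Type*) [MetricSpace T] [SMul G T] : Prop :=
  ∀ S : Set T, S.Nonempty → TreeConvex S → (∀ g : G, ∀ x ∈ S, g • x ∈ S) → S = univ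

/-- The minimal subtree for the subset `H` of `G`: the intersection of all nonempty
invariant subtrees. -/
def minSubtreeOf {G : Type*} (H : Set G) (T : Type*) [MetricSpace T] [SMul G T] : Set T :=
  ⋂₀ {S : Set T | S.Nonempty ∧ TreeConvex S ∧ ∀ g ∈ H, ∀ x ∈ S, g • x ∈ S}

/-- The minimal subtree of the `G`-action. -/
def minSubtree (G T : Type*) [MetricSpace T] [SMul G T] : Set T :=
  minSubtreeOf (univ : Set G) T

/-- A line in `T`: the image of an isometric embedding of `ℝ`. -/
def IsLine {T : Type*} [MetricSpace T] (L : Set T) : Prop :=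
  ∃ f : ℝ → T, (∀ s t : ℝ, dist (f s) (f t) = |s - t|) ∧ L = range f

/-- A ray in `T`: the image of an isometric embedding of `[0,∞)`. -/
def IsRay {T : Type*} [MetricSpace T] (R : Set T) : Prop :=
  ∃ f : ℝ → T, (∀ s ∈ Ici (0 : ℝ), ∀ t ∈ Ici (0 : ℝ), dist (f s) (f t) = |s - t|) ∧
    R = f '' Ici 0

/-- Two rays (or subsets) define the same end when they are at finite Hausdorff distance. -/
def SameEnd {T : Type*} [MetricSpace T] (R R' : Set T) : Prop :=
  EMetric.hausdorffEdist R R' ≠ ⊤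

/-- The action of `G` fixes an end of `T`. -/
def GFixedEnd (G T : Type*) [MetricSpace T] [SMul G T] : Prop :=
  ∃ R : Set T, IsRay R ∧ ∀ g : G, SameEnd ((fun x => g • x) '' R) R

/-- The action of `G` has an invariant line. -/
def GInvariantLine (G T : Type*) [MetricSpace T] [SMul G T] : Prop :=
  ∃ L : Set T, IsLine L ∧ ∀ g : G, (fun x => g • x) '' L = L

/-- The action is irreducible: no invariant line and no fixed end. -/
def IrreducibleAction (G T : Type*) [MetricSpace T] [SMul G T] : Prop :=
  ¬ GInvariantLine G T ∧ ¬ GFixedEnd G T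

/-- The action is dihedral: there is an invariant line on which some element acts as a
reflection (i.e. with non-constant displacement along the line). -/
def DihedralAction (G T : Type*) [MetricSpace T] [SMul G T] : Prop :=
  ∃ L : Set T, IsLine L ∧ (∀ g : G, (fun x => g • x) '' L = L) ∧
    ∃ g : G, ∃ x ∈ L, ∃ y ∈ L, dist x (g • x) ≠ dist y (g • y)

/-- `A` is a positive semi-axis of `g`: a ray contained in the axis of `g` and mapped
into itself by `g`. -/
def PosSemiAxis {G : Type*} (T : Type*) [MetricSpace T] [SMul G T] (g : G) (A : Set T) :
    Prop :=
  IsRay A ∧ A ⊆ axisSet T g ∧ (fun x => g • x) '' A ⊆ A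

/-- `g` translates towards the end determined by the ray `R`:
`g` is hyperbolic and has a positive semi-axis defining the same end as `R`. -/
def TranslatesToward {G : Type*} (T : Type*) [MetricSpace T] [SMul G T] (g : G)
    (R : Set T) : Prop :=
  Hyperbolic T g ∧ ∃ A : Set T, PosSemiAxis T g A ∧ SameEnd A R

/-- The end `ω_T(g)` of the hyperbolic element `g` lies in the set of ends of `δ`:
some positive semi-axis of `g` is contained in `δ`. -/
def EndInSubtree {G : Type*} (T : Type*) [MetricSpace T] [SMul G T] (g : G)
    (δ : Set T) : Prop :=
  ∃ A : Set T, PosSemiAxis T g A ∧ A ⊆ δ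

/-- A map between `ℝ`-trees preserves alignment if the image of a point between `y`
and `z` lies between the images of `y` and `z`. -/
def AlignPreserving {T T' : Type*} [MetricSpace T] [MetricSpace T'] (f : T → T') : Prop :=
  ∀ x y z : T, x ∈ seg y z → f x ∈ seg (f y) (f z)

/-- `f : T → T'` witnesses that `T` is a refinement of `T'`: it is an equivariant
continuous surjection preserving alignment. -/
def IsRefinementMap (G : Type*) {T T' : Type*} [Group G] [MetricSpace T] [MetricSpace T']
    [MulAction G T] [MulAction G T'] (f : T → T') : Prop :=
  Continuous f ∧ Surjective f ∧ AlignPreserving f ∧ ∀ (g : G) (x : T), f (g • x) = g • f x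

/-- The length functions of the two actions are homothetic. -/
def HomotheticLengths (G T₁ T₂ : Type*) [MetricSpace T₁] [MetricSpace T₂] [SMul G T₁]
    [SMul G T₂] : Prop :=
  ∃ c : ℝ, 0 < c ∧ ∀ g : G, translationLength T₁ g = c * translationLength T₂ g

/-- A bundled `ℝ`-tree with an isometric action of `G`. -/
structure GTree (G : Type*) [Group G] where
  carrier : Type
  [ms : MetricSpace carrier]
  [ma : MulAction G carrier]
  isom : ∀ (g : G) (x y : carrier), dist (g • x) (g • y) = dist x y
  tree : IsRTree carrier

attribute [instance] GTree.ms GTree.ma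

/-- A simplicial structure on an `ℝ`-tree: a vertex set containing all branch points,
meeting every segment in a finite set, and discrete. -/
def IsSimplicialStructure {T : Type*} [MetricSpace T] (V : Set T) : Prop :=
  (∀ x : T, IsBranchPoint x → x ∈ V) ∧
  (∀ x y : T, (seg x y ∩ V).Finite) ∧
  (∀ v ∈ V, ∃ ε > 0, ∀ w ∈ V, dist v w < ε → w = v)

/-- Two vertices of a simplicial tree are adjacent (span an edge). -/
def Adjacent {T : Type*} [MetricSpace T] (V : Set T) (v w : T) : Prop :=
  v ∈ V ∧ w ∈ V ∧ v ≠ w ∧ seg v w ∩ V = {v, w}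

/-- A bundled simplicial `G`-tree. -/
structure SimplicialGTree (G : Type*) [Group G] extends GTree G where
  V : Set carrier
  simp : IsSimplicialStructure V
  inv : ∀ g : G, (fun x => g • x) '' V = V

/-- `T₁` and `T₂` are refinements of a common non-trivial simplicial action of `G`. -/
def RefineCommonSimplicial (G T₁ T₂ : Type*) [Group G] [MetricSpace T₁] [MetricSpace T₂]
    [MulAction G T₁] [MulAction G T₂] : Prop :=
  ∃ T' : SimplicialGTree G, NontrivialAction G T'.carrier ∧
    (∃ f₁ : T₁ → T'.carrier, IsRefinementMap G f₁) ∧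
    (∃ f₂ : T₂ → T'.carrier, IsRefinementMap G f₂)

/-- Two directions face each other: their union is the whole tree. -/
def FacingDirections {T : Type*} [MetricSpace T] (δ δ' : Set T) : Prop :=
  δ ∪ δ' = univ

/-- There is a twice-light rectangle with (opposite) base corners `x` and `x'`:
two light quadrants based at `x` and `x'` facing each other. -/
def IsTwiceLightRect (G : Type*) {T₁ T₂ : Type*} [Group G] [MetricSpace T₁]
    [MetricSpace T₂] [MulAction G T₁] [MulAction G T₂] (x x' : T₁ × T₂) : Prop :=
  ∃ (δ₁ : Set T₁) (δ₂ : Set T₂) (δ₁' : Set T₁) (δ₂' : Set T₂),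
    IsDirectionAt δ₁ x.1 ∧ IsDirectionAt δ₂ x.2 ∧
    IsDirectionAt δ₁' x'.1 ∧ IsDirectionAt δ₂' x'.2 ∧
    x.1 ≠ x'.1 ∧ x.2 ≠ x'.2 ∧
    FacingDirections δ₁ δ₁' ∧ FacingDirections δ₂ δ₂' ∧
    ¬ Heavy G (δ₁ ×ˢ δ₂) ∧ ¬ Heavy G (δ₁' ×ˢ δ₂')

/-- The open rectangle with opposite corners `x, x'`. -/
def openRect {T₁ T₂ : Type*} [MetricSpace T₁] [MetricSpace T₂] (x x' : T₁ × T₂) :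
    Set (T₁ × T₂) :=
  openSeg x.1 x'.1 ×ˢ openSeg x.2 x'.2

/-- A maximal twice-light rectangle. -/
def IsMaxTwiceLightRect (G : Type*) {T₁ T₂ : Type*} [Group G] [MetricSpace T₁]
    [MetricSpace T₂] [MulAction G T₁] [MulAction G T₂] (x x' : T₁ × T₂) : Prop :=
  IsTwiceLightRect G x x' ∧ ∀ y y' : T₁ × T₂, IsTwiceLightRect G y y' →
    openRect x x' ⊆ openRect y y' → openRect x x' = openRect y y'

/-- The straight diagonal of a rectangle joining the two opposite corners `p` and `q`. -/
def mainDiag {T₁ T₂ : Type*} [MetricSpace T₁] [MetricSpace T₂] (p q : T₁ × T₂) :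
    Set (T₁ × T₂) :=
  {z : T₁ × T₂ | z.1 ∈ seg p.1 q.1 ∧ z.2 ∈ seg p.2 q.2 ∧
    dist p.1 z.1 * dist p.2 q.2 = dist p.2 z.2 * dist p.1 q.1}

/-- The augmented core: the union of the core and of the main diagonals of the maximal
twice-light rectangles (the diagonals joining the two opposite corners lying in the core). -/
def AugCore (G T₁ T₂ : Type*) [Group G] [MetricSpace T₁] [MetricSpace T₂]
    [MulAction G T₁] [MulAction G T₂] : Set (T₁ × T₂) :=
  Core G T₁ T₂ ∪
    {z : T₁ × T₂ | ∃ x x' p q : T₁ × T₂, IsMaxTwiceLightRect G x x' ∧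
      p ∈ Core G T₁ T₂ ∧ q ∈ Core G T₁ T₂ ∧
      ({p.1, q.1} : Set T₁) = {x.1, x'.1} ∧ ({p.2, q.2} : Set T₂) = {x.2, x'.2} ∧
      p.1 ≠ q.1 ∧ p.2 ≠ q.2 ∧ z ∈ mainDiag p q}

/-- There exists an equivariant (strong) deformation retraction of `T₁ × T₂` onto `C`. -/
def EquivDeformRetract (G : Type*) {T₁ T₂ : Type*} [Group G] [MetricSpace T₁]
    [MetricSpace T₂] [MulAction G T₁] [MulAction G T₂] (C : Set (T₁ × T₂)) : Prop :=
  ∃ H : ℝ → T₁ × T₂ → T₁ × T₂,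
    Continuous (fun p : ℝ × (T₁ × T₂) => H p.1 p.2) ∧
    (∀ z : T₁ × T₂, H 0 z = z) ∧
    (∀ z : T₁ × T₂, H 1 z ∈ C) ∧
    (∀ t : ℝ, ∀ z ∈ C, H t z = z) ∧
    (∀ (t : ℝ) (g : G) (z : T₁ × T₂), H t (g • z) = g • H t z)

/-- The `ℓ²` product distance on `T₁ × T₂`. -/
def dist2 {T₁ T₂ : Type*} [MetricSpace T₁] [MetricSpace T₂] (p q : T₁ × T₂) : ℝ :=
  Real.sqrt (dist p.1 q.1 ^ 2 + dist p.2 q.2 ^ 2)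

/-- The length of a path `c : [0,1] → T₁ × T₂`, measured with the `ℓ²` product metric. -/
def pathLen2 {T₁ T₂ : Type*} [MetricSpace T₁] [MetricSpace T₂] (c : ℝ → T₁ × T₂) :
    ℝ≥0∞ :=
  ⨆ (n : ℕ) (u : Fin (n + 1) → ℝ) (_ : Monotone u) (_ : ∀ i, u i ∈ Icc (0 : ℝ) 1),
    ∑ i : Fin n, ENNReal.ofReal (dist2 (c (u i.castSucc)) (c (u i.succ)))

/-- The path metric induced on a subset `C ⊆ T₁ × T₂` by the `ℓ²` product metric. -/
def pathDistOn {T₁ T₂ : Type*} [MetricSpace T₁] [MetricSpace T₂] (C : Set (T₁ × T₂))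
    (x y : C) : ℝ :=
  (⨅ (c : ℝ → T₁ × T₂) (_ : ContinuousOn c (Icc (0 : ℝ) 1))
      (_ : MapsTo c (Icc (0 : ℝ) 1) C) (_ : c 0 = (x : T₁ × T₂))
      (_ : c 1 = (y : T₁ × T₂)), pathLen2 c).toReal

/-- A distance function makes a set a CAT(0) space: it is a metric, geodesic, and the
CN-inequality of Bruhat–Tits holds (comparison triangles are at least as thick). -/
structure IsCAT0Dist {X : Type*} (d : X → X → ℝ) : Prop where
  refl : ∀ x, d x x = 0
  symm : ∀ x y, d x y = d y x
  triangle : ∀ x y z, d x z ≤ d x y + d y z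
  eq_of_dist_eq_zero : ∀ x y, d x y = 0 → x = y
  geodesic : ∀ x y, ∃ f : ℝ → X, f 0 = x ∧ f (d x y) = y ∧
    ∀ s ∈ Icc (0 : ℝ) (d x y), ∀ t ∈ Icc (0 : ℝ) (d x y), d (f s) (f t) = |s - t|
  cn : ∀ x y z m, d y m = d y z / 2 → d m z = d y z / 2 →
    d x m ^ 2 ≤ (d x y ^ 2 + d x z ^ 2) / 2 - d y z ^ 2 / 4

/-- A 2-cell of the core of a product of two simplicial trees: a rectangle which is a
product of two edges and is contained in the core. -/
def IsCoreCell (G : Type*) {T₁ T₂ : Type*} [Group G] [MetricSpace T₁] [MetricSpace T₂]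
    [MulAction G T₁] [MulAction G T₂] (V₁ : Set T₁) (V₂ : Set T₂)
    (R : Set (T₁ × T₂)) : Prop :=
  ∃ v₁ w₁ v₂ w₂, Adjacent V₁ v₁ w₁ ∧ Adjacent V₂ v₂ w₂ ∧
    R = seg v₁ w₁ ×ˢ seg v₂ w₂ ∧ R ⊆ Core G T₁ T₂


section Geometry

variable {T : Type*} [MetricSpace T]

/-- The image of a geodesic parametrization lies between its endpoints. -/
lemma geod_mem_seg {x y : T} {f : ℝ → T} (h0 : f 0 = x) (h1 : f (dist x y) = y)
    (hf : ∀ s ∈ Icc (0 : ℝ) (dist x y), ∀ t ∈ Icc (0 : ℝ) (dist x y),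
      dist (f s) (f t) = |s - t|) {s : ℝ} (hs : s ∈ Icc (0 : ℝ) (dist x y)) :
    dist x (f s) = s ∧ dist (f s) y = dist x y - s := by
  have hD : (0 : ℝ) ≤ dist x y := dist_nonneg
  have a := hf 0 ⟨le_rfl, hD⟩ s hs
  have b := hf s hs (dist x y) ⟨hD, le_rfl⟩
  rw [h0] at a
  rw [h1] at b
  rw [a, b]
  constructor
  · rw [zero_sub, abs_neg, abs_of_nonneg hs.1]
  · rw [abs_sub_comm, abs_of_nonneg (by linarith [hs.2])]

lemma geod_continuousOn {I : Set ℝ} {f : ℝ → T}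
    (hf : ∀ s ∈ I, ∀ t ∈ I, dist (f s) (f t) = |s - t|) : ContinuousOn f I := by
  have : LipschitzOnWith 1 f I :=
    LipschitzOnWith.of_dist_le_mul fun s hs t ht => by
      rw [hf s hs t ht, Real.dist_eq]; simp
  exact this.continuousOn

/-- An isometrically parametrized segment yields an injective path. -/
lemma exists_injective_path {a b : ℝ} (hab : a ≠ b) {f : ℝ → T}
    (hf : ∀ s ∈ uIcc a b, ∀ t ∈ uIcc a b, dist (f s) (f t) = |s - t|) :
    ∃ γ : Path (f a) (f b), Injective γ ∧ range γ ⊆ f '' uIcc a b := by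
  have hmem : ∀ t : unitInterval, a + t * (b - a) ∈ uIcc a b := by
    intro t
    have h0 := t.2.1
    have h1 := t.2.2
    rcases le_total a b with h | h
    · rw [uIcc_of_le h]; constructor <;> nlinarith
    · rw [uIcc_of_ge h]; constructor <;> nlinarith
  refine ⟨⟨⟨fun t => f (a + t * (b - a)), ?_⟩, by simp, by simp⟩, ?_, ?_⟩
  · exact (geod_continuousOn hf).comp_continuous (by fun_prop) hmem
  · intro s t hst
    have h : f (a + s * (b - a)) = f (a + t * (b - a)) := hst
    have h2 := hf _ (hmem s) _ (hmem t)
    rw [h, dist_self] at h2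
    have h3 := abs_eq_zero.1 h2.symm
    have h4 : ((s : ℝ) - t) * (b - a) = 0 := by linarith
    rcases mul_eq_zero.1 h4 with h5 | h5
    · exact Subtype.ext (by linarith)
    · exact absurd (by linarith) hab
  · rintro _ ⟨t, rfl⟩
    exact ⟨_, hmem t, rfl⟩

lemma injective_trans {x y z : T} {γ : Path x y} {γ' : Path y z} (h : Injective γ)
    (h' : Injective γ') (hi : range γ ∩ range γ' ⊆ {y}) : Injective (γ.trans γ') := by
  have key : ∀ s t : unitInterval, (s : ℝ) ≤ 1 / 2 → ¬ (t : ℝ) ≤ 1 / 2 →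
      γ.trans γ' s ≠ γ.trans γ' t := by
    intro s t hs ht hst
    rw [Path.trans_apply, Path.trans_apply, dif_pos hs, dif_neg ht] at hst
    have hy : γ' ⟨2 * t - 1, unitInterval.two_mul_sub_one_mem_iff.2
        ⟨(not_le.1 ht).le, t.2.2⟩⟩ = y := hi ⟨⟨_, hst⟩, ⟨_, rfl⟩⟩
    have h0 := h' (hy.trans γ'.source.symm)
    have h1 : 2 * (t : ℝ) - 1 = 0 := congrArg Subtype.val h0
    exact ht (by linarith)
  intro s t hst
  by_cases hs : (s : ℝ) ≤ 1 / 2 <;> by_cases ht : (t : ℝ) ≤ 1 / 2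
  · rw [Path.trans_apply, Path.trans_apply, dif_pos hs, dif_pos ht] at hst
    have h1 : 2 * (s : ℝ) = 2 * t := congrArg Subtype.val (h hst)
    exact Subtype.ext (by linarith)
  · exact absurd hst (key s t hs ht)
  · exact absurd hst.symm (key t s ht hs)
  · rw [Path.trans_apply, Path.trans_apply, dif_neg hs, dif_neg ht] at hst
    have h1 : 2 * (s : ℝ) - 1 = 2 * t - 1 := congrArg Subtype.val (h' hst)
    exact Subtype.ext (by linarith)

/-- Projection of a point of an `ℝ`-tree onto a geodesic segment. -/
lemma IsRTree.exists_proj (hT : IsRTree T) {x y : T} {f : ℝ → T}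
    (hf : ∀ s ∈ Icc (0 : ℝ) (dist x y), ∀ t ∈ Icc (0 : ℝ) (dist x y),
      dist (f s) (f t) = |s - t|) (z : T) :
    ∃ a ∈ Icc (0 : ℝ) (dist x y), ∀ b ∈ Icc (0 : ℝ) (dist x y),
      dist z (f b) = dist z (f a) + |a - b| := by
  have hcont : ContinuousOn (fun s => dist z (f s)) (Icc (0 : ℝ) (dist x y)) :=
    (continuous_const.dist continuous_id).comp_continuousOn (geod_continuousOn hf)
  obtain ⟨a, ha, hmin⟩ := isCompact_Icc.exists_isMinOn (nonempty_Icc.2 dist_nonneg) hcont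
  refine ⟨a, ha, fun b hb => ?_⟩
  rw [← hf a ha b hb]
  by_cases hza : z = f a
  · rw [← hza, dist_self, zero_add]
  by_cases hab : a = b
  · rw [hab, dist_self, add_zero]
  obtain ⟨e, he0, he1, he⟩ := hT.exists_geod z (f a)
  obtain ⟨e', he0', he1', he'⟩ := hT.exists_geod z (f b)
  have hD : 0 < dist z (f a) := dist_pos.2 hza
  have hzb : z ≠ f b := by
    rintro rfl
    have h1 : dist (f b) (f a) ≤ dist (f b) (f b) := hmin hb
    rw [dist_self] at h1
    linarith
  have hD' : 0 < dist z (f b) := dist_pos.2 hzb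
  obtain ⟨γ₁, hi₁, hr₁⟩ := exists_injective_path (f := e) hD.ne
    (by rw [uIcc_of_le hD.le]; exact he)
  have hsub : uIcc a b ⊆ Icc 0 (dist x y) := ordConnected_Icc.uIcc_subset ha hb
  obtain ⟨γ₂, hi₂, hr₂⟩ := exists_injective_path (f := f) hab
    (fun s hs t ht => hf s (hsub hs) t (hsub ht))
  obtain ⟨γ₃, hi₃, hr₃⟩ := exists_injective_path (f := e') hD'.ne
    (by rw [uIcc_of_le hD'.le]; exact he')
  rw [uIcc_of_le hD.le] at hr₁
  rw [uIcc_of_le hD'.le] at hr₃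
  have hi : range (γ₁.cast he0.symm he1.symm) ∩ range γ₂ ⊆ {f a} := by
    rintro p ⟨hp1, hp2⟩
    obtain ⟨s, hs, rfl⟩ := hr₁ (by simpa using hp1)
    obtain ⟨t, ht, hts⟩ := hr₂ hp2
    have h1 : dist z (f a) ≤ dist z (f t) := hmin (hsub ht)
    have h2 := geod_mem_seg he0 he1 he hs
    rw [hts] at h1
    have h3 : dist (e s) (f a) = 0 := le_antisymm (by linarith [h2.1, h2.2, hs.2]) dist_nonneg
    exact dist_eq_zero.1 h3
  have hinj := injective_trans (γ := γ₁.cast he0.symm he1.symm) (by simpa using hi₁) hi₂ hi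
  have hrange := hT.arc_unique _ _ _ (γ₃.cast he0'.symm he1'.symm) hinj (by simpa using hi₃)
  have hmem : f a ∈ range (γ₃.cast he0'.symm he1'.symm) := by
    rw [← hrange, Path.trans_range]
    exact Or.inr ⟨0, γ₂.source⟩
  obtain ⟨s, hs, hsa⟩ := hr₃ (by simpa using hmem)
  have h2 := geod_mem_seg he0' he1' he' hs
  rw [hsa] at h2
  linarith [h2.1, h2.2]

/-- The four-point condition: `ℝ`-trees are `0`-hyperbolic. -/
lemma IsRTree.four_point (hT : IsRTree T) (x y z w : T) :
    dist x y + dist z w ≤ max (dist x z + dist y w) (dist x w + dist y z) := by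
  obtain ⟨f, h0, h1, hf⟩ := hT.exists_geod x y
  have hD : (0 : ℝ) ≤ dist x y := dist_nonneg
  obtain ⟨a, ha, hza⟩ := hT.exists_proj hf z
  obtain ⟨b, hb, hwb⟩ := hT.exists_proj hf w
  have e1 := hza 0 ⟨le_rfl, hD⟩
  have e2 := hza _ ⟨hD, le_rfl⟩
  have e3 := hwb 0 ⟨le_rfl, hD⟩
  have e4 := hwb _ ⟨hD, le_rfl⟩
  have e5 := hza b hb
  have e6 := dist_triangle z (f b) w
  rw [h0, sub_zero, abs_of_nonneg ha.1] at e1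
  rw [h1, abs_sub_comm, abs_of_nonneg (by linarith [ha.2])] at e2
  rw [h0, sub_zero, abs_of_nonneg hb.1] at e3
  rw [h1, abs_sub_comm, abs_of_nonneg (by linarith [hb.2])] at e4
  rw [dist_comm z x] at e1
  rw [dist_comm z y] at e2
  rw [dist_comm w x] at e3
  rw [dist_comm w y] at e4
  rw [dist_comm (f b) w] at e6
  rcases le_total a b with h | h
  · rw [abs_sub_comm, abs_of_nonneg (by linarith)] at e5
    exact le_max_of_le_right (by linarith)
  · rw [abs_of_nonneg (by linarith)] at e5
    exact le_max_of_le_left (by linarith)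

lemma IsRTree.exists_median (hT : IsRTree T) (x y z : T) :
    ∃ q, q ∈ seg x y ∧ q ∈ seg z x ∧ q ∈ seg z y := by
  obtain ⟨f, h0, h1, hf⟩ := hT.exists_geod x y
  obtain ⟨a, ha, hza⟩ := hT.exists_proj hf z
  have hD : (0 : ℝ) ≤ dist x y := dist_nonneg
  have e0 := geod_mem_seg h0 h1 hf ha
  have e1 := hza 0 ⟨le_rfl, hD⟩
  have e2 := hza _ ⟨hD, le_rfl⟩
  rw [h0, sub_zero, abs_of_nonneg ha.1] at e1
  rw [h1, abs_sub_comm, abs_of_nonneg (by linarith [ha.2])] at e2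
  refine ⟨f a, ?_, ?_, ?_⟩
  · simp only [seg, mem_ofPred_eq]; linarith [e0.1, e0.2]
  · simp only [seg, mem_ofPred_eq]; rw [dist_comm (f a) x]; linarith [e0.1, e0.2]
  · simp only [seg, mem_ofPred_eq]; linarith [e0.1, e0.2]

/-- A concatenation of segments overlapping in a nondegenerate segment is a segment. -/
lemma IsRTree.dist_eq_of_overlap (hT : IsRTree T) {a b c d : T} (hb : b ∈ seg a c)
    (hc : c ∈ seg b d) (hbc : b ≠ c) :
    dist a d = dist a b + dist b c + dist c d := by
  simp only [seg, mem_ofPred_eq] at hb hc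
  have hpos := dist_pos.2 hbc
  have t1 := dist_triangle4 a b c d
  rcases le_max_iff.1 (hT.four_point a c b d) with h | h <;>
    [skip; rw [dist_comm c b] at h] <;> linarith

lemma IsRTree.mem_component (hT : IsRTree T) {x y z : T} (h : x ∉ seg y z) :
    z ∈ connectedComponentIn {x}ᶜ y := by
  obtain ⟨f, h0, h1, hf⟩ := hT.exists_geod y z
  have hD : (0 : ℝ) ≤ dist y z := dist_nonneg
  have hpre : IsPreconnected (f '' Icc 0 (dist y z)) :=
    isPreconnected_Icc.image f (geod_continuousOn hf)
  refine hpre.subset_connectedComponentIn ⟨0, ⟨le_rfl, hD⟩, h0⟩ ?_ ⟨_, ⟨hD, le_rfl⟩, h1⟩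
  rintro _ ⟨s, hs, rfl⟩ hsx
  have e := geod_mem_seg h0 h1 hf hs
  rw [mem_singleton_iff] at hsx
  rw [hsx] at e
  exact h (show _ = _ by linarith [e.1, e.2])

lemma IsRTree.notMem_seg_of_mem_component (hT : IsRTree T) {x y z : T} (hyx : y ≠ x)
    (h : z ∈ connectedComponentIn {x}ᶜ y) : x ∉ seg y z := by
  set U : Set T := {z | dist y z < dist y x + dist x z}
  set V : Set T := {z | z ≠ x ∧ dist y x + dist x z ≤ dist y z}
  have hU : IsOpen U := isOpen_lt (by fun_prop) (by fun_prop)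
  have hV : IsOpen V := by
    rw [Metric.isOpen_iff]
    rintro u ⟨hu, hu'⟩
    refine ⟨dist u x, dist_pos.2 hu, fun w hw => ⟨?_, ?_⟩⟩
    · rintro rfl
      rw [mem_ball, dist_comm] at hw
      exact lt_irrefl _ hw
    · rw [mem_ball] at hw
      have := dist_nonneg (x := x) (y := w)
      rcases le_max_iff.1 (hT.four_point y u x w) with h | h <;>
        linarith [dist_comm u w, dist_comm u x, dist_comm x w, dist_comm u x]
  have hyU : y ∈ U := by
    have := dist_pos.2 hyx
    simp only [U, mem_ofPred_eq, dist_self]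
    linarith [dist_comm x y]
  have hsub : connectedComponentIn {x}ᶜ y ⊆ U :=
    isPreconnected_connectedComponentIn.subset_left_of_subset_union hU hV
      (disjoint_left.2 fun u hu hu' => not_lt.2 hu'.2 hu)
      (fun u hu => (lt_or_ge (dist y u) (dist y x + dist x u)).imp id
        fun h => ⟨connectedComponentIn_subset _ _ hu, h⟩)
      ⟨y, mem_connectedComponentIn hyx, hyU⟩
  exact fun hx => (hsub h).ne hx.symm

lemma IsDirectionAt.nonempty {δ : Set T} {x : T} (h : IsDirectionAt δ x) : δ.Nonempty := by
  obtain ⟨y, hy, rfl⟩ := h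
  exact ⟨y, mem_connectedComponentIn hy⟩

lemma IsDirectionAt.base_notMem {δ : Set T} {x : T} (h : IsDirectionAt δ x) : x ∉ δ := by
  obtain ⟨y, hy, rfl⟩ := h
  exact fun hx => connectedComponentIn_subset _ _ hx rfl

lemma IsDirectionAt.eq_component {δ : Set T} {x y : T} (h : IsDirectionAt δ x) (hy : y ∈ δ) :
    δ = connectedComponentIn {x}ᶜ y := by
  obtain ⟨u, hu, rfl⟩ := h
  exact connectedComponentIn_eq hy

/-- A direction at `x` consists of the points not separated by `x` from one of its points. -/
lemma IsDirectionAt.mem_iff (hT : IsRTree T) {δ : Set T} {x y z : T} (h : IsDirectionAt δ x)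
    (hy : y ∈ δ) : z ∈ δ ↔ x ∉ seg y z := by
  have hyx : y ≠ x := fun e => h.base_notMem (e ▸ hy)
  rw [h.eq_component hy]
  exact ⟨hT.notMem_seg_of_mem_component hyx, hT.mem_component⟩

lemma IsDirectionAt.mem_of_dist_lt (hT : IsRTree T) {δ : Set T} {x y z : T}
    (h : IsDirectionAt δ x) (hy : y ∈ δ) (hz : dist y z < dist y x) : z ∈ δ := by
  rw [h.mem_iff hT hy]
  intro hx
  have : dist y x + dist x z = dist y z := hx
  linarith [dist_nonneg (x := x) (y := z)]

lemma IsDirectionAt.isOpen (hT : IsRTree T) {δ : Set T} {x : T} (h : IsDirectionAt δ x) :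
    IsOpen δ := by
  rw [Metric.isOpen_iff]
  intro y hy
  have hyx : y ≠ x := fun e => h.base_notMem (e ▸ hy)
  refine ⟨dist y x, dist_pos.2 hyx, fun z hz => h.mem_of_dist_lt hT hy ?_⟩
  rwa [mem_ball, dist_comm] at hz

lemma IsDirectionAt.treeConvex_compl (hT : IsRTree T) {δ : Set T} {x : T}
    (h : IsDirectionAt δ x) : TreeConvex δᶜ := by
  intro u hu v hv w hw hwδ
  have hwx : w ≠ x := fun e => h.base_notMem (e ▸ hwδ)
  have hpos := dist_pos.2 hwx
  have h1 : dist w x + dist x u = dist w u := by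
    by_contra hc
    exact hu ((h.mem_iff hT hwδ).2 hc)
  have h2 : dist w x + dist x v = dist w v := by
    by_contra hc
    exact hv ((h.mem_iff hT hwδ).2 hc)
  have h3 : dist u w + dist w v = dist u v := hw
  linarith [dist_triangle u x v, dist_comm u w, dist_comm u x]

/-- A direction branching off the interior of `[x,x']` lies in both directions facing each
other along that segment. -/
lemma component_subset_inter (hT : IsRTree T) {x x' q z : T} {δ δ' : Set T}
    (hd : IsDirectionAt δ x) (hd' : IsDirectionAt δ' x') (hx' : x' ∈ δ) (hx : x ∈ δ')
    (hq : q ∈ seg x x') (hqx : q ≠ x) (hqx' : q ≠ x') (hzq : z ≠ q)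
    (hzx : q ∈ seg z x) (hzx' : q ∈ seg z x') :
    connectedComponentIn {q}ᶜ z ⊆ δ ∩ δ' := by
  have key : ∀ {u u' : T}, q ∈ seg u u' → q ≠ u → q ∈ seg z u →
      ∀ w ∈ connectedComponentIn {q}ᶜ z, u ∉ seg u' w := by
    intro u u' hqu hne hzu w hw hu
    refine hT.notMem_seg_of_mem_component hzq hw ?_
    simp only [seg, mem_ofPred_eq] at *
    have huw : u ∈ seg q w := by
      simp only [seg, mem_ofPred_eq]
      linarith [dist_triangle u' q w, dist_comm u' u, dist_comm u' q, dist_comm u q,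
        dist_triangle q u w]
    have := hT.dist_eq_of_overlap (a := z) hzu huw hne
    simp only [seg, mem_ofPred_eq] at huw
    linarith
  refine fun w hw => ⟨(hd.mem_iff hT hx').2 (key hq hqx hzx w hw),
    (hd'.mem_iff hT hx).2 (key ?_ hqx' hzx' w hw)⟩
  simp only [seg, mem_ofPred_eq] at *
  linarith [dist_comm x q, dist_comm x' q, dist_comm x x']

lemma openSeg_subset_direction (hT : IsRTree T) {x x' : T} {δ : Set T}
    (hd : IsDirectionAt δ x) (hx' : x' ∈ δ) : openSeg x x' ⊆ δ := by
  rintro p ⟨hp, hne⟩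
  have hpx : x ≠ p := fun e => hne (Or.inl e.symm)
  have hpos := dist_pos.2 hpx
  rw [hd.mem_iff hT hx']
  intro h
  simp only [seg, mem_ofPred_eq] at *
  linarith [dist_comm x x', dist_comm p x']

lemma openSeg_comm (x y : T) : openSeg x y = openSeg y x := by
  have : seg x y = seg y x := by
    ext p
    simp only [seg, mem_ofPred_eq]
    rw [dist_comm x p, dist_comm p y, dist_comm x y, add_comm]
  rw [openSeg, openSeg, this, pair_comm]

/-- If two facing directions intersect in more than an open segment with no branch point,
their intersection contains a direction. -/
lemma facing_inter_eq (hT : IsRTree T) {x x' : T} {δ δ' : Set T}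
    (hd : IsDirectionAt δ x) (hd' : IsDirectionAt δ' x') (hface : FacingDirections δ δ')
    (hno : ∀ η, IsDirection η → ¬ η ⊆ δ ∩ δ') :
    δ ∩ δ' = openSeg x x' ∧ ∀ p ∈ openSeg x x', ¬ IsBranchPoint p := by
  have hx' : x' ∈ δ := ((eq_univ_iff_forall.1 hface) x').resolve_right hd'.base_notMem
  have hx : x ∈ δ' := ((eq_univ_iff_forall.1 hface) x).resolve_left hd.base_notMem
  refine ⟨Subset.antisymm ?_ (subset_inter (openSeg_subset_direction hT hd hx')
    (openSeg_comm x x' ▸ openSeg_subset_direction hT hd' hx)), ?_⟩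
  · rintro z ⟨hz, hz'⟩
    by_contra hzs
    obtain ⟨q, hq, hqx, hqx'⟩ := hT.exists_median x x' z
    have hne : q ≠ x := by
      rintro rfl
      exact (hd.mem_iff hT hz).1 hx' hqx'
    have hne' : q ≠ x' := by
      rintro rfl
      exact (hd'.mem_iff hT hz').1 hx hqx
    have hzq : z ≠ q := by
      rintro rfl
      exact hzs ⟨hq, by simp [hne, hne']⟩
    exact hno _ ⟨q, z, hzq, rfl⟩
      (component_subset_inter hT hd hd' hx' hx hq hne hne' hzq hqx hqx')
  · rintro p ⟨hp, hne⟩ ⟨η₁, η₂, η₃, h₁, h₂, h₃, h₁₂, h₁₃, h₂₃⟩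
    simp only [mem_insert_iff, mem_singleton_iff, not_or] at hne
    have hall : ∀ η, IsDirectionAt η p → x ∈ η ∨ x' ∈ η := by
      intro η hη
      by_contra! hc
      obtain ⟨z, hz⟩ := hη.nonempty
      have hzp : z ≠ p := fun e => hη.base_notMem (e ▸ hz)
      have h1 : p ∈ seg z x := by
        by_contra h
        exact hc.1 ((hη.mem_iff hT hz).2 h)
      have h2 : p ∈ seg z x' := by
        by_contra h
        exact hc.2 ((hη.mem_iff hT hz).2 h)
      exact hno _ ⟨p, z, hzp, rfl⟩
        (component_subset_inter hT hd hd' hx' hx hp hne.1 hne.2 hzp h1 h2)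
    have huniq : ∀ {η η' u}, IsDirectionAt η p → IsDirectionAt η' p → u ∈ η → u ∈ η' →
        η = η' := fun h h' hu hu' => (h.eq_component hu).trans (h'.eq_component hu').symm
    rcases hall _ h₁ with a | a <;> rcases hall _ h₂ with b | b <;>
      rcases hall _ h₃ with c | c <;>
      first
        | exact h₁₂ (huniq h₁ h₂ a b)
        | exact h₁₃ (huniq h₁ h₃ a c)
        | exact h₂₃ (huniq h₂ h₃ b c)

end Geometry

section Actions

variable {G T : Type*} [Group G] [MetricSpace T] [MulAction G T]

lemma IsRTree.exists_midpoint (hT : IsRTree T) (x y : T) :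
    ∃ m, dist x m = dist x y / 2 ∧ dist m y = dist x y / 2 := by
  obtain ⟨f, h0, h1, hf⟩ := hT.exists_geod x y
  have hD : (0 : ℝ) ≤ dist x y := dist_nonneg
  have := geod_mem_seg h0 h1 hf (s := dist x y / 2) ⟨by linarith, by linarith⟩
  exact ⟨_, this.1, by linarith [this.2]⟩

/-- An isometry of an `ℝ`-tree without fixed point translates some point along an axis. -/
lemma exists_axis_point (hT : IsRTree T) (hiso : IsometricAction G T) {g : G}
    (hg : ∀ x : T, g • x ≠ x) (y : T) :
    ∃ m : T, 0 < dist m (g • m) ∧ ∀ n : ℕ, dist m (g ^ n • m) = n * dist m (g • m) := by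
  obtain ⟨m, hm1, hm2⟩ := hT.exists_midpoint y (g • y)
  have hne : m ≠ g • m := (hg m).symm
  have hpos : 0 < dist m (g • m) := dist_pos.2 hne
  refine ⟨m, hpos, ?_⟩
  have a1 := hiso g y m
  have a2 := hiso g m (g • y)
  have a3 := hiso g y (g • y)
  have b1 := hiso g (g • y) (g • m)
  have b2 := hiso g (g • m) (g • g • y)
  have b3 := hiso g (g • y) (g • g • y)
  have b4 := hiso g m (g • m)
  have b5 := hiso g y (g • g • y)
  have hl : dist m (g • m) = dist y (g • g • y) - dist y (g • y) := by
    apply le_antisymm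
    · have p1 := hT.four_point m (g • m) y (g • y)
      have p2 := hT.four_point (g • m) y (g • y) (g • g • y)
      rcases le_max_iff.1 p1 with h | h <;> rcases le_max_iff.1 p2 with h' | h' <;>
        linarith [dist_comm y m, dist_comm (g • y) (g • m), dist_comm y (g • m),
          dist_comm y (g • y)]
    · linarith [dist_triangle4 y m (g • m) (g • g • y)]
  have hm2' : dist m (g • g • m) = 2 * dist m (g • m) := by
    apply le_antisymm
    · linarith [dist_triangle m (g • m) (g • g • m)]
    · have t1 := dist_triangle y m (g • g • y)
      have t2 := dist_triangle (g • y) (g • g • m) (g • g • g • y)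
      have p := hT.four_point m (g • g • y) (g • y) (g • g • m)
      rcases le_max_iff.1 p with h | h <;>
        linarith [dist_comm (g • g • y) (g • y)]
  have hmid : ∀ n : ℕ, dist (g ^ n • m) (g ^ (n + 1) • m) = dist m (g • m) := fun n => by
    rw [pow_succ, mul_smul, hiso]
  have hmid2 : ∀ n : ℕ, dist (g ^ n • m) (g ^ (n + 2) • m) = 2 * dist m (g • m) := fun n => by
    rw [pow_add, mul_smul, hiso, pow_two, mul_smul, hm2']
  have main : ∀ n : ℕ, dist m (g ^ n • m) = n * dist m (g • m) ∧
      dist m (g ^ (n + 1) • m) = (n + 1) * dist m (g • m) := by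
    intro n
    induction n with
    | zero => simp
    | succ n ih =>
      refine ⟨by push_cast; exact ih.2, ?_⟩
      have h1 := hmid n
      have h2 := hmid (n + 1)
      have h3 := hmid2 n
      have hov := hT.dist_eq_of_overlap (a := m) (b := g ^ n • m) (c := g ^ (n + 1) • m)
        (d := g ^ (n + 2) • m) (show _ = _ by rw [ih.1, ih.2, h1]; ring)
        (show _ = _ by rw [h1, h2, h3]; ring) (dist_pos.1 (by rw [h1]; exact hpos))
      rw [show n + 1 + 1 = n + 2 from rfl, hov, h1, h2, ih.1]
      push_cast
      ring
  exact fun n => (main n).1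

lemma tendsto_dist_smul_of_tendsto (hiso : IsometricAction G T) {γ : ℕ → G} {a : T}
    (h : Tendsto (fun k => dist (γ k • a) a) atTop atTop) (y z : T) :
    Tendsto (fun k => dist (γ k • y) z) atTop atTop := by
  refine tendsto_atTop_mono (fun k => ?_)
    (tendsto_atTop_add_const_right _ (-(dist a y + dist z a)) h)
  have h1 := hiso (γ k) a y
  have h2 := dist_triangle4 (γ k • a) (γ k • y) z a
  linarith

lemma tendsto_pow_smul (hT : IsRTree T) (hiso : IsometricAction G T) {g : G}
    (hg : ∀ x : T, g • x ≠ x) (y : T) :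
    Tendsto (fun n : ℕ => dist (g ^ n • y) y) atTop atTop := by
  obtain ⟨m, hpos, hm⟩ := exists_axis_point hT hiso hg y
  refine tendsto_dist_smul_of_tendsto hiso (a := m) ?_ y y
  simp_rw [dist_comm _ m, hm]
  exact tendsto_natCast_atTop_atTop.atTop_mul_const hpos

lemma eventually_mem_direction (hT : IsRTree T) (hiso : IsometricAction G T) {γ : ℕ → G}
    {a : T} {δ : Set T} (hδ : IsDirection δ)
    (h : Tendsto (fun k => dist (γ k • a) a) atTop atTop) (y z : T) :
    ∀ᶠ k in atTop, γ k • y ∈ δ → γ k • z ∈ δ := by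
  obtain ⟨p, hp⟩ := hδ
  filter_upwards [(tendsto_dist_smul_of_tendsto hiso h y p).eventually_gt_atTop (dist y z)]
    with k hk hy
  exact hp.mem_of_dist_lt hT hy (by rwa [hiso])

/-- Every direction contains a forward end of a hyperbolic element. -/
lemma exists_translating_into (hT : IsRTree T) (hiso : IsometricAction G T)
    (hnt : NontrivialAction G T) (hdense : Dense (minSubtree G T)) {η : Set T}
    (hη : IsDirection η) :
    ∃ g : G, ∀ y z : T, (∀ᶠ n : ℕ in atTop, g ^ n • y ∈ η) ∧
      Tendsto (fun n : ℕ => dist (g ^ n • y) z) atTop atTop := by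
  obtain ⟨p, hp⟩ := hη
  obtain ⟨h, hh⟩ := hnt
  obtain ⟨m, hpos, hm⟩ := exists_axis_point hT hiso hh p
  obtain ⟨k, hk⟩ : ∃ k : G, k • m ∈ η := by
    by_contra! hc
    have hsub : minSubtree G T ⊆ {u | ∀ k : G, k • u ∉ η} := by
      refine sInter_subset_of_mem ⟨⟨m, hc⟩, ?_, ?_⟩
      · intro u hu v hv w hw k
        refine hp.treeConvex_compl hT _ (hu k) _ (hv k) ?_
        simpa only [seg, mem_ofPred_eq, hiso k] using hw
      · intro g _ u hu k
        rw [← mul_smul]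
        exact hu _
    obtain ⟨u, hu, hu'⟩ := hdense.inter_open_nonempty _ (hp.isOpen hT) hp.nonempty
    exact hsub hu' 1 (by rwa [one_smul])
  obtain ⟨a, ha⟩ : ∃ a, a = k • m := ⟨_, rfl⟩
  rw [← ha] at hk
  obtain ⟨g, hgk⟩ : ∃ g, g = k * h * k⁻¹ := ⟨_, rfl⟩
  have hga : ∀ n : ℕ, g ^ n • a = k • h ^ n • m := fun n => by
    simp only [hgk, ha, conj_pow, mul_smul, inv_smul_smul]
  have hdist : ∀ n : ℕ, dist a (g ^ n • a) = n * dist m (h • m) := fun n => by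
    rw [hga, ha, hiso, hm]
  have hdist' : ∀ n : ℕ, dist a (g⁻¹ ^ n • a) = n * dist m (h • m) := fun n => by
    rw [← hiso (g ^ n), ← mul_smul (g ^ n) (g⁻¹ ^ n), inv_pow, mul_inv_cancel, one_smul,
      dist_comm, hdist]
  have fin : ∀ f : G, (∀ n : ℕ, dist a (f ^ n • a) = n * dist m (h • m)) →
      (∀ n : ℕ, f ^ n • a ∈ η) → ∃ g : G, ∀ y z : T, (∀ᶠ n : ℕ in atTop, g ^ n • y ∈ η) ∧
      Tendsto (fun n : ℕ => dist (g ^ n • y) z) atTop atTop := by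
    intro f hf hfη
    have ht : Tendsto (fun n : ℕ => dist (f ^ n • a) a) atTop atTop := by
      simp_rw [dist_comm _ a, hf]
      exact tendsto_natCast_atTop_atTop.atTop_mul_const hpos
    refine ⟨f, fun y z => ⟨?_, tendsto_dist_smul_of_tendsto hiso ht y z⟩⟩
    filter_upwards [eventually_mem_direction hT hiso ⟨p, hp⟩ ht a y] with n hn
    exact hn (hfη n)
  by_cases hall : ∀ n : ℕ, g ^ n • a ∈ η
  · exact fin g hdist hall
  refine fin g⁻¹ hdist' fun i => (hp.mem_iff hT hk).2 fun hi => ?_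
  push Not at hall
  obtain ⟨n, hn⟩ := hall
  have hn' : dist a p + dist p (g ^ n • a) = dist a (g ^ n • a) := by
    by_contra hc
    exact hn ((hp.mem_iff hT hk).2 hc)
  have hi' : dist a p + dist p (g⁻¹ ^ i • a) = dist a (g⁻¹ ^ i • a) := hi
  have hap : 0 < dist a p := dist_pos.2 fun e => hp.base_notMem (e ▸ hk)
  have htot : dist (g⁻¹ ^ i • a) (g ^ n • a) = (i + n) * dist m (h • m) := by
    rw [← hiso (g ^ i), ← mul_smul, ← mul_smul, inv_pow, mul_inv_cancel, one_smul, ← pow_add,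
      hdist]
    push_cast
    ring
  rw [hdist] at hn'
  rw [hdist'] at hi'
  linarith [dist_triangle (g⁻¹ ^ i • a) p (g ^ n • a), dist_comm p (g⁻¹ ^ i • a)]

end Actions

section Products

variable {G T₁ T₂ : Type*} [Group G] [MetricSpace T₁] [MetricSpace T₂]
  [MulAction G T₁] [MulAction G T₂]

lemma Heavy.mono {Q Q' : Set (T₁ × T₂)} (h : Heavy G Q) (hQ : Q ⊆ Q') : Heavy G Q' := by
  intro p
  obtain ⟨γ, h1, h2⟩ := h p
  exact ⟨γ, fun k => hQ (h1 k), h2⟩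

lemma Heavy.swap {δ₁ : Set T₁} {δ₂ : Set T₂} (h : Heavy G (δ₁ ×ˢ δ₂)) :
    Heavy G (δ₂ ×ˢ δ₁) := by
  intro p
  obtain ⟨γ, h1, h2, h3⟩ := h p.swap
  exact ⟨γ, fun k => ⟨(h1 k).2, (h1 k).1⟩, h3, h2⟩

lemma heavy_of_frequently (hT₁ : IsRTree T₁) (hT₂ : IsRTree T₂)
    (hiso₁ : IsometricAction G T₁) (hiso₂ : IsometricAction G T₂)
    {η : Set T₁} {δ : Set T₂} (hη : IsDirection η) (hδ : IsDirection δ)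
    {γ : ℕ → G} {a₁ : T₁} {a₂ : T₂} (hmem : ∃ᶠ k in atTop, γ k • a₁ ∈ η ∧ γ k • a₂ ∈ δ)
    (h₁ : Tendsto (fun k => dist (γ k • a₁) a₁) atTop atTop)
    (h₂ : Tendsto (fun k => dist (γ k • a₂) a₂) atTop atTop) :
    Heavy G (η ×ˢ δ) := by
  intro p
  have hfreq : ∃ᶠ k in atTop, γ k • p.1 ∈ η ∧ γ k • p.2 ∈ δ := by
    refine (hmem.and_eventually
      ((eventually_mem_direction hT₁ hiso₁ hη h₁ a₁ p.1).and
        (eventually_mem_direction hT₂ hiso₂ hδ h₂ a₂ p.2))).mono ?_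
    rintro k ⟨⟨h1, h2⟩, h3, h4⟩
    exact ⟨h3 h1, h4 h2⟩
  obtain ⟨φ, hφ, hφ'⟩ := extraction_of_frequently_atTop hfreq
  exact ⟨γ ∘ φ, hφ', (tendsto_dist_smul_of_tendsto hiso₁ h₁ p.1 p.1).comp hφ.tendsto_atTop,
    (tendsto_dist_smul_of_tendsto hiso₂ h₂ p.2 p.2).comp hφ.tendsto_atTop⟩

/-- A strip `η × T₂` contains orbit points going to infinity in both coordinates. -/
lemma exists_seq_in_strip (hT₁ : IsRTree T₁) (hT₂ : IsRTree T₂)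
    (hiso₁ : IsometricAction G T₁) (hiso₂ : IsometricAction G T₂)
    (hnt₁ : NontrivialAction G T₁) (hnt₂ : NontrivialAction G T₂)
    (hdense₁ : Dense (minSubtree G T₁)) {η : Set T₁} (hη : IsDirection η)
    (a₁ : T₁) (a₂ : T₂) :
    ∃ γ : ℕ → G, (∀ᶠ k in atTop, γ k • a₁ ∈ η) ∧
      Tendsto (fun k => dist (γ k • a₁) a₁) atTop atTop ∧
      Tendsto (fun k => dist (γ k • a₂) a₂) atTop atTop := by
  obtain ⟨g, hg⟩ := exists_translating_into hT₁ hiso₁ hnt₁ hdense₁ hη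
  by_cases hell : ∀ x : T₂, g • x ≠ x
  · exact ⟨fun n => g ^ n, (hg a₁ a₁).1, (hg a₁ a₁).2, tendsto_pow_smul hT₂ hiso₂ hell a₂⟩
  push Not at hell
  obtain ⟨q, hq⟩ := hell
  have hqn : ∀ n : ℕ, g ^ n • q = q := fun n => by
    induction n with
    | zero => simp
    | succ n ih => rw [pow_succ, mul_smul, hq, ih]
  obtain ⟨h, hh⟩ := hnt₂
  have hex : ∀ k : ℕ, ∃ n : ℕ, g ^ n • h ^ k • a₁ ∈ η ∧
      (k : ℝ) ≤ dist (g ^ n • h ^ k • a₁) a₁ := fun k =>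
    ((hg (h ^ k • a₁) a₁).1.and ((hg (h ^ k • a₁) a₁).2.eventually_ge_atTop (k : ℝ))).exists
  choose n hn1 hn2 using hex
  refine ⟨fun k => g ^ n k * h ^ k, Eventually.of_forall fun k => ?_, ?_, ?_⟩
  · rw [mul_smul]
    exact hn1 k
  · refine tendsto_atTop_mono (fun k => ?_) tendsto_natCast_atTop_atTop
    rw [mul_smul]
    exact hn2 k
  · refine tendsto_dist_smul_of_tendsto hiso₂ (a := q) ?_ a₂ a₂
    refine (tendsto_pow_smul hT₂ hiso₂ hh q).congr fun k => ?_
    rw [mul_smul, ← hiso₂ (g ^ n k), hqn]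

/-- Two quadrants over the same first direction, whose second directions face each other,
cannot both be light. -/
lemma heavy_or_heavy (hT₁ : IsRTree T₁) (hT₂ : IsRTree T₂)
    (hiso₁ : IsometricAction G T₁) (hiso₂ : IsometricAction G T₂)
    (hnt₁ : NontrivialAction G T₁) (hnt₂ : NontrivialAction G T₂)
    (hdense₁ : Dense (minSubtree G T₁)) {η : Set T₁} (hη : IsDirection η)
    {δ δ' : Set T₂} (hδ : IsDirection δ) (hδ' : IsDirection δ')
    (hface : FacingDirections δ δ') :
    Heavy G (η ×ˢ δ) ∨ Heavy G (η ×ˢ δ') := by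
  obtain ⟨a₁, -⟩ := id hη
  obtain ⟨a₂, -⟩ := id hδ
  obtain ⟨γ, hmem, h₁, h₂⟩ := exists_seq_in_strip hT₁ hT₂ hiso₁ hiso₂ hnt₁ hnt₂ hdense₁
    hη a₁ a₂
  have hor : ∃ᶠ k in atTop, (γ k • a₁ ∈ η ∧ γ k • a₂ ∈ δ) ∨ (γ k • a₁ ∈ η ∧ γ k • a₂ ∈ δ') :=
    (hmem.mono fun k hk => ((eq_univ_iff_forall.1 hface) (γ k • a₂)).imp
      (fun h => ⟨hk, h⟩) (fun h => ⟨hk, h⟩)).frequently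
  exact (frequently_or_distrib.1 hor).imp
    (heavy_of_frequently hT₁ hT₂ hiso₁ hiso₂ hη hδ · h₁ h₂)
    (heavy_of_frequently hT₁ hT₂ hiso₁ hiso₂ hη hδ' · h₁ h₂)

end Products

/-- Proposition 4.3: a twice-light rectangle, i.e. the intersection of
two light quadrants facing each other, is exactly the open rectangle spanned by the two
base points, and its sides contain no branch point. -/
theorem twice_light_rectangle_is_rectangle
    {G T₁ T₂ : Type*} [Group G] [MetricSpace T₁] [MetricSpace T₂]
    [MulAction G T₁] [MulAction G T₂]
    (hT₁ : IsRTree T₁) (hT₂ : IsRTree T₂)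
    (hiso₁ : IsometricAction G T₁) (hiso₂ : IsometricAction G T₂)
    (hnt₁ : NontrivialAction G T₁) (hnt₂ : NontrivialAction G T₂)
    (hdense₁ : Dense (minSubtree G T₁)) (hdense₂ : Dense (minSubtree G T₂))
    (x₁ x₁' : T₁) (x₂ x₂' : T₂) (δ₁ : Set T₁) (δ₂ : Set T₂) (δ₁' : Set T₁) (δ₂' : Set T₂)
    (hd₁ : IsDirectionAt δ₁ x₁) (hd₂ : IsDirectionAt δ₂ x₂)
    (hd₁' : IsDirectionAt δ₁' x₁') (hd₂' : IsDirectionAt δ₂' x₂')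
    (hx₁ : x₁ ≠ x₁') (hx₂ : x₂ ≠ x₂')
    (hface₁ : FacingDirections δ₁ δ₁') (hface₂ : FacingDirections δ₂ δ₂')
    (hlight : ¬ Heavy G (δ₁ ×ˢ δ₂)) (hlight' : ¬ Heavy G (δ₁' ×ˢ δ₂')) :
    (δ₁ ×ˢ δ₂) ∩ (δ₁' ×ˢ δ₂') = openSeg x₁ x₁' ×ˢ openSeg x₂ x₂' ∧
    (∀ p ∈ openSeg x₁ x₁', ¬ IsBranchPoint p) ∧
    (∀ p ∈ openSeg x₂ x₂', ¬ IsBranchPoint p) := by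
  have hno₁ : ∀ η, IsDirection η → ¬ η ⊆ δ₁ ∩ δ₁' := by
    intro η hη hsub
    rcases heavy_or_heavy hT₁ hT₂ hiso₁ hiso₂ hnt₁ hnt₂ hdense₁ hη ⟨_, hd₂⟩ ⟨_, hd₂'⟩ hface₂
      with h | h
    · exact hlight (h.mono (prod_mono (fun z hz => (hsub hz).1) Subset.rfl))
    · exact hlight' (h.mono (prod_mono (fun z hz => (hsub hz).2) Subset.rfl))
  have hno₂ : ∀ η, IsDirection η → ¬ η ⊆ δ₂ ∩ δ₂' := by
    intro η hη hsub
    rcases heavy_or_heavy hT₂ hT₁ hiso₂ hiso₁ hnt₂ hnt₁ hdense₂ hη ⟨_, hd₁⟩ ⟨_, hd₁'⟩ hface₁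
      with h | h
    · exact hlight (h.swap.mono (prod_mono Subset.rfl (fun z hz => (hsub hz).1)))
    · exact hlight' (h.swap.mono (prod_mono Subset.rfl (fun z hz => (hsub hz).2)))
  have h₁ := facing_inter_eq hT₁ hd₁ hd₁' hface₁ hno₁
  have h₂ := facing_inter_eq hT₂ hd₂ hd₂' hface₂ hno₂
  refine ⟨?_, h₁.2, h₂.2⟩
  rw [prod_inter_prod, h₁.1, h₂.1]

end Guirardel
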